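/- Constrained zonotopes are closed under affine transformations: for any r ∈ ℝ^m, R ∈ ℝ^{m×n}, and constrained zonotope Z₁ = ⟨c₁, G₁, F₁, θ₁⟩ ⊆ ℝ^n, the image set {r + R x : x ∈ Z₁} equals the constrained zonotope ⟨r + R c₁, R G₁, F₁, θ₁⟩ ⊆ ℝ^m. -/

import Mathlib

open Matrix

/-- The constrained zonotope `⟨c, G, F, θ⟩ = {x : x = c + Gξ, ‖ξ‖_∞ ≤ 1, Fξ = θ}`.
(The norm on `ng → ℝ` is the supremum norm.) -/
def constrainedZonotope {n ng nc : Type*} [Fintype n] [Fintype ng] [Fintype nc]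
    (c : n → ℝ) (G : Matrix n ng ℝ) (F : Matrix nc ng ℝ) (θ : nc → ℝ) :
    Set (n → ℝ) :=
  {x | ∃ ξ : ng → ℝ, x = c + G.mulVec ξ ∧ ‖ξ‖ ≤ 1 ∧ F.mulVec ξ = θ}

/-- Constrained zonotopes are closed under affine transformations:
`r + R ⟨c₁, G₁, F₁, θ₁⟩ = ⟨r + R c₁, R G₁, F₁, θ₁⟩`. -/
theorem constrainedZonotope_affine_image {n m ng nc : ℕ}
    (r : Fin m → ℝ) (R : Matrix (Fin m) (Fin n) ℝ)
    (c₁ : Fin n → ℝ) (G₁ : Matrix (Fin n) (Fin ng) ℝ)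
    (F₁ : Matrix (Fin nc) (Fin ng) ℝ) (θ₁ : Fin nc → ℝ) :
    (fun x => r + R.mulVec x) '' constrainedZonotope c₁ G₁ F₁ θ₁ =
      constrainedZonotope (r + R.mulVec c₁) (R * G₁) F₁ θ₁ := by
  have affine_comp (ξ : Fin ng → ℝ) :
      r + R.mulVec (c₁ + G₁.mulVec ξ) = r + R.mulVec c₁ + (R * G₁).mulVec ξ := by
    rw [mulVec_add, mulVec_mulVec, add_assoc]
  ext y
  constructor
  · rintro ⟨_, ⟨ξ, rfl, hξ⟩, rfl⟩
    exact ⟨ξ, affine_comp ξ, hξ⟩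
  · rintro ⟨ξ, rfl, hξ⟩
    exact ⟨c₁ + G₁.mulVec ξ, ⟨ξ, rfl, hξ⟩, affine_comp ξ⟩
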